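/- Universal approximation by one-layer MLPs (Hornik, case m = 0, as stated in Theorem 1 of the paper): Let φ : ℝ → ℝ be continuous, bounded and non-constant. Then for every compact set K ⊆ ℝᵖ, every continuous function f : ℝᵖ → ℝ, and every ν > 0, there exist n ∈ ℕ, coefficients c₁,…,c_n ∈ ℝ, weight vectors w₁,…,w_n ∈ ℝᵖ and biases b₁,…,b_n ∈ ℝ such that sup_{x ∈ K} | f(x) − Σ_{i=1}^n c_i φ(⟨w_i, x⟩ + b_i) | ≤ ν. -/

import Mathlib

open Matrix MeasureTheory

open Filter Topology Polynomial

/-- Over `ℝ`, every polynomial has an antiderivative. -/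
theorem exists_polynomial_derivative_eq (q : ℝ[X]) : ∃ p : ℝ[X], derivative p = q := by
  induction q using Polynomial.induction_on' with
  | add q₁ q₂ h₁ h₂ =>
    obtain ⟨p₁, rfl⟩ := h₁
    obtain ⟨p₂, rfl⟩ := h₂
    exact ⟨p₁ + p₂, derivative_add⟩
  | monomial n a =>
    refine ⟨monomial (n + 1) (a / (n + 1)), ?_⟩
    rw [derivative_monomial]
    congr 1
    push_cast
    field_simp

/-- A smooth function with a vanishing iterated derivative is a polynomial function. -/
theorem exists_polynomial_of_iteratedDeriv_eq_zero (k : ℕ) {g : ℝ → ℝ} (hg : ContDiff ℝ k g)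
    (h : ∀ t, iteratedDeriv k g t = 0) : ∃ p : ℝ[X], ∀ t, g t = p.eval t := by
  induction k generalizing g with
  | zero => exact ⟨0, fun t ↦ by simpa using h t⟩
  | succ k ih =>
    have hg' : ContDiff ℝ (k + 1) g := mod_cast hg
    obtain ⟨q, hq⟩ := ih (contDiff_succ_iff_deriv.1 hg').2.2
      (fun t ↦ by rw [← iteratedDeriv_succ']; exact h t)
    obtain ⟨p, rfl⟩ := exists_polynomial_derivative_eq q
    have hd : Differentiable ℝ g := hg'.differentiable (by simp)
    have hc := is_const_of_deriv_eq_zero (f := fun t ↦ g t - p.eval t)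
      (hd.sub p.differentiable)
      (fun t ↦ by rw [deriv_fun_sub (hd t) p.differentiableAt, hq, Polynomial.deriv, sub_self])
    refine ⟨p + C (g 0 - p.eval 0), fun t ↦ ?_⟩
    have := hc t 0
    simp only [eval_add, eval_C]
    linarith

/-- A bounded smooth function with a vanishing iterated derivative is constant. -/
theorem eq_const_of_bounded_of_iteratedDeriv_eq_zero {k : ℕ} {g : ℝ → ℝ} (hg : ContDiff ℝ k g)
    (h : ∀ t, iteratedDeriv k g t = 0) {M : ℝ} (hM : ∀ t, |g t| ≤ M) :
    ∃ a, ∀ t, g t = a := by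
  obtain ⟨p, hp⟩ := exists_polynomial_of_iteratedDeriv_eq_zero k hg h
  have hdeg : p.degree ≤ 0 := p.isBoundedUnder_abs_atTop_iff.1
    (isBoundedUnder_of ⟨M, fun t ↦ by simpa [← hp] using hM t⟩)
  refine ⟨p.coeff 0, fun t ↦ ?_⟩
  rw [hp, eq_C_of_degree_le_zero hdeg, eval_C, coeff_C_zero]

/-- A closed subspace is stable under integration. -/
theorem Submodule.integral_mem_of_isClosed {α E : Type*} [MeasurableSpace α] {μ : Measure α}
    [NormedAddCommGroup E] [NormedSpace ℝ E] [CompleteSpace E] (S : Submodule ℝ E)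
    (hS : IsClosed (S : Set E)) {F : α → E} (hF : Integrable F μ) (hFS : ∀ s, F s ∈ S) :
    ∫ s, F s ∂μ ∈ S := by
  have := hS
  rw [← S.ker_mkQ, LinearMap.mem_ker]
  have h := S.mkQL.integral_comp_comm hF
  have h0 : ∀ s, S.mkQL (F s) = 0 := fun s ↦ (Submodule.Quotient.mk_eq_zero S).2 (hFS s)
  simp only [h0, integral_zero] at h
  exact h.symm

section ContinuousMap

variable {X : Type*} [TopologicalSpace X] [CompactSpace X]

/-- If a family of continuous functions lies in a closed subspace, then so does its pointwise
derivative with respect to the parameter, provided it is jointly continuous. -/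
theorem curry_mem_of_hasDerivAt (S : Submodule ℝ C(X, ℝ)) (hS : IsClosed (S : Set C(X, ℝ)))
    (F F' : C(ℝ × X, ℝ)) (hF : ∀ t, F.curry t ∈ S)
    (hd : ∀ t x, HasDerivAt (fun t ↦ F (t, x)) (F' (t, x)) t) (t : ℝ) : F'.curry t ∈ S := by
  have hint : ∀ s, ∫ r in t..s, F'.curry r = F.curry s - F.curry t := by
    intro s
    ext x
    have h := (ContinuousMap.evalCLM ℝ x).intervalIntegral_comp_comm
      (F'.curry.continuous.intervalIntegrable (μ := volume) t s)
    have h' := intervalIntegral.integral_eq_sub_of_hasDerivAt (fun r _ ↦ hd r x)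
      ((by fun_prop : Continuous fun r ↦ F' (r, x)).intervalIntegrable t s)
    exact h.symm.trans h'
  have hD : HasDerivAt (fun s ↦ F.curry s - F.curry t) (F'.curry t) t := by
    simp only [← hint]
    exact intervalIntegral.integral_hasDerivAt_right
      (F'.curry.continuous.intervalIntegrable t t)
      F'.curry.continuous.stronglyMeasurable.stronglyMeasurableAtFilter
      F'.curry.continuous.continuousAt
  refine hS.mem_of_tendsto hD.tendsto_slope (Eventually.of_forall fun s ↦ ?_)
  rw [slope_def_module]
  exact S.smul_mem _ (S.sub_mem (S.sub_mem (hF s) (hF t)) (S.sub_mem (hF t) (hF t)))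

/-- If a closed subspace contains all translates `φ ∘ (u + b)`, it also contains the translates of
any mollification of `φ`. -/
theorem mollification_comp_mem (S : Submodule ℝ C(X, ℝ)) (hS : IsClosed (S : Set C(X, ℝ)))
    (φ η ψ : C(ℝ, ℝ)) (hη : HasCompactSupport η) (hψ : ∀ t, ψ t = ∫ s, η s * φ (t - s))
    (u : C(X, ℝ)) (hu : ∀ b : ℝ, φ.comp (u + .const X b) ∈ S) (b : ℝ) :
    ψ.comp (u + .const X b) ∈ S := by
  let F : C(ℝ × X, ℝ) := ⟨fun z ↦ φ (u z.2 + b - z.1), by fun_prop⟩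
  have hFc : Continuous fun s ↦ η s • F.curry s := η.continuous.smul F.curry.continuous
  have hFi : Integrable (fun s ↦ η s • F.curry s) :=
    hFc.integrable_of_hasCompactSupport hη.smul_right
  have hmem := S.integral_mem_of_isClosed hS hFi fun s ↦ S.smul_mem _ <| by
    convert hu (b - s) using 1
    ext x
    simp [F, add_sub_assoc]
  convert hmem using 1
  ext x
  have h := (ContinuousMap.evalCLM ℝ x).integral_comp_comm hFi
  refine Eq.trans ?_ h
  simp [hψ, F]

/-- If a closed subspace contains all ridge functions `g ∘ (t • u + b)` with `g` smooth and no
iterated derivative of `g` vanishes identically, it contains all powers of `u`. -/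
theorem pow_mem_of_ridge_mem (S : Submodule ℝ C(X, ℝ)) (hS : IsClosed (S : Set C(X, ℝ)))
    (g : C(ℝ, ℝ)) (hg : ContDiff ℝ (⊤ : ℕ∞) g) (u : C(X, ℝ))
    (hu : ∀ t b : ℝ, g.comp (t • u + .const X b) ∈ S) (k : ℕ)
    (hk : ∃ t, iteratedDeriv k g t ≠ 0) : u ^ k ∈ S := by
  have hc : ∀ k : ℕ, Continuous (iteratedDeriv k g) := fun k ↦
    hg.continuous_iteratedDeriv k (by exact_mod_cast le_top)
  let F (b : ℝ) (k : ℕ) : C(ℝ × X, ℝ) :=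
    ⟨fun z ↦ u z.2 ^ k * iteratedDeriv k g (z.1 * u z.2 + b),
      by have := hc k; fun_prop⟩
  have key : ∀ b k t, (F b k).curry t ∈ S := by
    intro b k
    induction k with
    | zero =>
      intro t
      convert hu t b using 1
      ext x
      simp [F]
    | succ k ih =>
      refine curry_mem_of_hasDerivAt S hS (F b k) (F b (k + 1)) ih fun t x ↦ ?_
      have hdg : HasDerivAt (iteratedDeriv k g) (iteratedDeriv (k + 1) g (t * u x + b))
          (t * u x + b) := by
        rw [iteratedDeriv_succ]
        exact (hg.differentiable_iteratedDeriv k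
          (by exact_mod_cast WithTop.coe_lt_top _) _).hasDerivAt
      have hin : HasDerivAt (fun t ↦ t * u x + b) (u x) t := by
        simpa using ((hasDerivAt_id t).mul_const (u x)).add_const b
      refine ((hdg.comp t hin).const_mul (u x ^ k)).congr_deriv ?_
      change _ = u x ^ (k + 1) * iteratedDeriv (k + 1) g (t * u x + b)
      ring
  obtain ⟨b, hb⟩ := hk
  have h := S.smul_mem (iteratedDeriv k g b)⁻¹ (key b k 0)
  convert h using 1
  ext x
  have hx : u x ^ k = (iteratedDeriv k g b)⁻¹ * (u x ^ k * iteratedDeriv k g b) := by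
    field_simp
  simpa [F] using hx

/-- A closed subspace of `C(X, ℝ)` containing all powers of the functions in a point-separating
linear space is everything. -/
theorem eq_top_of_pow_mem (S : Submodule ℝ C(X, ℝ)) (hS : IsClosed (S : Set C(X, ℝ)))
    (U : Submodule ℝ C(X, ℝ)) (hU : ∀ x y, x ≠ y → ∃ u ∈ U, u x ≠ u y)
    (hpow : ∀ u ∈ U, ∀ k : ℕ, u ^ k ∈ S) : S = ⊤ := by
  have hexp : ∀ u ∈ U, NormedSpace.exp u ∈ S := fun u hu ↦
    hS.mem_of_tendsto (NormedSpace.exp_series_hasSum_exp' (𝕂 := ℝ) u)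
      (Eventually.of_forall fun s ↦ S.sum_mem fun k _ ↦ S.smul_mem _ (hpow u hu k))
  let N : Submonoid C(X, ℝ) :=
    { carrier := NormedSpace.exp '' (U : Set C(X, ℝ))
      one_mem' := ⟨0, U.zero_mem, NormedSpace.exp_zero⟩
      mul_mem' := by
        rintro _ _ ⟨u, hu, rfl⟩ ⟨v, hv, rfl⟩
        exact ⟨u + v, U.add_mem hu hv, NormedSpace.exp_add⟩ }
  let A : Subalgebra ℝ C(X, ℝ) := Algebra.adjoin ℝ (N : Set C(X, ℝ))
  have hAS : Subalgebra.toSubmodule A ≤ S := by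
    rw [Algebra.adjoin_eq_span, Submonoid.closure_eq, Submodule.span_le]
    rintro _ ⟨u, hu, rfl⟩
    exact hexp u hu
  have hsep : A.SeparatesPoints := by
    intro x y hxy
    obtain ⟨u, hu, hne⟩ := hU x y hxy
    refine ⟨_, ⟨NormedSpace.exp u, Algebra.subset_adjoin ⟨u, hu, rfl⟩, rfl⟩, fun h ↦ hne ?_⟩
    have he : ∀ z, NormedSpace.exp u z = Real.exp (u z) := fun z ↦ by
      rw [Real.exp_eq_exp_ℝ]
      exact NormedSpace.map_exp (ContinuousMap.evalAlgHom ℝ ℝ z)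
        (by exact continuous_eval_const z) u
    exact Real.exp_injective (by simpa only [he] using h)
  have htop := ContinuousMap.subalgebra_topologicalClosure_eq_top_of_separatesPoints A hsep
  refine eq_top_iff.2 fun f _ ↦ ?_
  have hf : f ∈ A.topologicalClosure := htop ▸ Algebra.mem_top
  exact closure_minimal (fun a ha ↦ hAS ha) hS hf

/-- A closed subspace of `C(X, ℝ)` containing all ridge functions `φ ∘ (u + b)`, with `u` in a
point-separating linear space and `φ` bounded and non-constant, is everything. -/
theorem eq_top_of_ridge_mem (S : Submodule ℝ C(X, ℝ)) (hS : IsClosed (S : Set C(X, ℝ)))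
    (U : Submodule ℝ C(X, ℝ)) (hU : ∀ x y, x ≠ y → ∃ u ∈ U, u x ≠ u y)
    (φ : C(ℝ, ℝ)) {M : ℝ} (hM : ∀ t, |φ t| ≤ M) (hφ : ¬ ∃ a, ∀ t, φ t = a)
    (hφS : ∀ u ∈ U, ∀ b : ℝ, φ.comp (u + .const X b) ∈ S) : S = ⊤ := by
  obtain ⟨t₀, ht₀⟩ : ∃ t, φ t ≠ φ 0 := by
    by_contra! h
    exact hφ ⟨_, h⟩
  let β (n : ℕ) : ContDiffBump (0 : ℝ) :=
    ⟨1 / (n + 1) / 2, 1 / (n + 1), by positivity, half_lt_self (by positivity)⟩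
  have hβ : Tendsto (fun n ↦ (β n).rOut) atTop (𝓝 0) := tendsto_one_div_add_atTop_nhds_zero_nat
  have hlim := fun t ↦ ContDiffBump.convolution_tendsto_right_of_continuous (μ := volume)
    hβ φ.continuous t
  obtain ⟨n, hn⟩ := (((hlim t₀).sub (hlim 0)).eventually_ne (sub_ne_zero.2 ht₀)).exists
  let η : C(ℝ, ℝ) := ⟨(β n).normed volume, (β n).continuous_normed⟩
  have hη : HasCompactSupport η := (β n).hasCompactSupport_normed
  have hsmooth := hη.contDiff_convolution_left (n := (⊤ : ℕ∞)) (ContinuousLinearMap.lsmul ℝ ℝ)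
    ((β n).contDiff_normed (μ := volume) (n := (⊤ : ℕ∞)))
    (φ.continuous.locallyIntegrable (μ := volume))
  let ψ : C(ℝ, ℝ) := ⟨_, hsmooth.continuous⟩
  have hψ : ∀ t, ψ t = ∫ s, η s * φ (t - s) := fun t ↦ rfl
  have hψM : ∀ t, |ψ t| ≤ M := by
    intro t
    rw [hψ]
    have hi : Integrable η volume := η.continuous.integrable_of_hasCompactSupport hη
    calc |∫ s, η s * φ (t - s)| ≤ ∫ s, η s * M := by
          rw [← Real.norm_eq_abs]
          refine norm_integral_le_of_norm_le (hi.mul_const M) (Eventually.of_forall fun s ↦ ?_)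
          have hs : 0 ≤ η s := (β n).nonneg_normed s
          rw [norm_mul, Real.norm_of_nonneg hs]
          exact mul_le_mul_of_nonneg_left (hM _) hs
      _ = M := by
          rw [integral_mul_const]
          exact (congrArg (· * M) (β n).integral_normed).trans (one_mul M)
  refine eq_top_of_pow_mem S hS U hU fun u hu k ↦
    pow_mem_of_ridge_mem S hS ψ hsmooth u (fun t b ↦ mollification_comp_mem S hS φ η ψ hη hψ _
      (hφS _ (U.smul_mem t hu)) b) k ?_
  by_contra! h
  obtain ⟨a, ha⟩ := eq_const_of_bounded_of_iteratedDeriv_eq_zero (hsmooth.of_le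
    (by exact_mod_cast le_top)) h hψM
  exact hn (sub_eq_zero.2 ((ha t₀).trans (ha 0).symm))

end ContinuousMap

/-- universal approximation by one-layer MLPs, Hornik, case m = 0: For a
continuous, bounded, non-constant activation `φ : ℝ → ℝ`, every continuous
`f : ℝᵖ → ℝ` can be approximated to within any `ν > 0` uniformly on any compact
`K ⊆ ℝᵖ` by a one-layer MLP `x ↦ ∑ i, c i * φ(⟨w i, x⟩ + b i)`. -/
theorem universal_approximation_one_layer_mlp
    {p : ℕ} (φ : ℝ → ℝ) (hφc : Continuous φ)
    (hφb : ∃ M : ℝ, ∀ t : ℝ, |φ t| ≤ M)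
    (hφnc : ¬ ∃ a : ℝ, ∀ t : ℝ, φ t = a)
    (K : Set (Fin p → ℝ)) (hK : IsCompact K)
    (f : (Fin p → ℝ) → ℝ) (hf : Continuous f)
    (ν : ℝ) (hν : 0 < ν) :
    ∃ (n : ℕ) (c : Fin n → ℝ) (w : Fin n → (Fin p → ℝ)) (b : Fin n → ℝ),
      ∀ x ∈ K, |f x - ∑ i, c i * φ (w i ⬝ᵥ x + b i)| ≤ ν := by
  obtain ⟨M, hM⟩ := hφb
  have := isCompact_iff_compactSpace.1 hK
  let Φ : C(ℝ, ℝ) := ⟨φ, hφc⟩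
  let L : (Fin p → ℝ) →ₗ[ℝ] C(K, ℝ) :=
    { toFun := fun w ↦ ⟨fun x ↦ w ⬝ᵥ (x : Fin p → ℝ), by fun_prop⟩
      map_add' := fun w v ↦ by ext x; simp [add_dotProduct]
      map_smul' := fun a w ↦ by ext x; simp [smul_dotProduct] }
  let R : Set C(K, ℝ) := Set.range fun z : (Fin p → ℝ) × ℝ ↦ Φ.comp (L z.1 + .const K z.2)
  have htop : (Submodule.span ℝ R).topologicalClosure = ⊤ := by
    refine eq_top_of_ridge_mem _ (Submodule.isClosed_topologicalClosure _) (LinearMap.range L)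
      (fun x y hxy ↦ ?_) Φ hM hφnc ?_
    · obtain ⟨i, hi⟩ : ∃ i, (x : Fin p → ℝ) i ≠ (y : Fin p → ℝ) i := by
        by_contra! h
        exact hxy (Subtype.ext (funext h))
      exact ⟨_, ⟨Pi.single i 1, rfl⟩, by simpa [L] using hi⟩
    · rintro _ ⟨w, rfl⟩ b
      exact Submodule.le_topologicalClosure _ (Submodule.subset_span ⟨(w, b), rfl⟩)
  let f' : C(K, ℝ) := ⟨fun x ↦ f x, by fun_prop⟩
  have hf' : f' ∈ closure (Submodule.span ℝ R : Set C(K, ℝ)) := by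
    rw [← Submodule.topologicalClosure_coe, htop]
    trivial
  obtain ⟨g, hg, hfg⟩ := Metric.mem_closure_iff.1 hf' ν hν
  obtain ⟨n, c, r, rfl⟩ := Submodule.mem_span_set'.1 hg
  choose z hz using fun i ↦ (r i).2
  refine ⟨n, c, fun i ↦ (z i).1, fun i ↦ (z i).2, fun x hx ↦ ?_⟩
  have h := (ContinuousMap.dist_apply_le_dist (f := f')
    (g := ∑ i, c i • (r i : C(K, ℝ))) ⟨x, hx⟩).trans hfg.le
  simpa [← hz, Real.dist_eq, f', Φ, L] using h
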